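/- Let p > 1 and γ, λ, μ ∈ ℝ. There exists a constant C > 0, depending only on p, such that for every measurable v : ℝ² → ℂ with ‖v‖_p < ∞, the function L(v) = γ·(v ⋆ v† ⋆ v) + λμ·(v ⋆ (σ·(v ⋆ v†))) is defined almost everywhere (all convolution integrals converging absolutely a.e.) and satisfies ‖L(v)‖_p ≤ C·(|γ| + |λμ|)·‖v‖_p³. -/

import Mathlib

open MeasureTheory Filter
open scoped ENNReal Topology

/-- The weighted norm `‖v‖_p = (∫ (1 + |k| + |m|)^(2p) |v(k,m)|² dk dm)^(1/2)` on `ℝ²`. -/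
noncomputable def wnorm (p : ℝ) (v : ℝ × ℝ → ℂ) : ℝ≥0∞ :=
  (∫⁻ km : ℝ × ℝ, ENNReal.ofReal ((1 + |km.1| + |km.2|) ^ (2 * p)) * (‖v km‖₊ : ℝ≥0∞) ^ 2) ^
    ((1 : ℝ) / 2)

/-- The convolution `(f ⋆ g)(ξ) = ∫ f (ξ - η) g η dη` over `ℝ²`. -/
noncomputable def conv (f g : ℝ × ℝ → ℂ) : ℝ × ℝ → ℂ :=
  fun ξ => ∫ η : ℝ × ℝ, f (ξ - η) * g η

/-- `v†(k,m) = conj (v (-k, -m))`, the Fourier transform of the complex conjugate. -/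
def dag (v : ℝ × ℝ → ℂ) : ℝ × ℝ → ℂ :=
  fun km => starRingEnd ℂ (v (-km))

/-- `σ(k,m) = k² / (k² + m²)` for `(k,m) ≠ 0`, and `σ(0,0) = 0`. -/
noncomputable def sigmaMul : ℝ × ℝ → ℝ :=
  fun km => if km = 0 then 0 else km.1 ^ 2 / (km.1 ^ 2 + km.2 ^ 2)

/-- The Fourier-side Davey–Stewartson-II nonlinearity
`L(v) = γ (v ⋆ v† ⋆ v) + λμ (v ⋆ (σ · (v ⋆ v†)))`. -/
noncomputable def Lop (γ lam μ : ℝ) (v : ℝ × ℝ → ℂ) : ℝ × ℝ → ℂ :=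
  fun km => (γ : ℂ) * conv (conv v (dag v)) v km +
    ((lam * μ : ℝ) : ℂ) * conv v (fun η => (sigmaMul η : ℂ) * conv v (dag v) η) km

/-- The weight `(1 + |k| + |m|)^p`, as an extended nonnegative real. -/
noncomputable def wt (p : ℝ) (x : ℝ × ℝ) : ℝ≥0∞ := ENNReal.ofReal ((1 + |x.1| + |x.2|) ^ p)

/-- The square of the weighted norm, for functions with values in `ℝ≥0∞`. -/
noncomputable def wsq (p : ℝ) (F : ℝ × ℝ → ℝ≥0∞) : ℝ≥0∞ := ∫⁻ x, (wt p x * F x) ^ 2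

/-- Convolution of functions with values in `ℝ≥0∞`. -/
noncomputable def lconv (F G : ℝ × ℝ → ℝ≥0∞) (ξ : ℝ × ℝ) : ℝ≥0∞ := ∫⁻ η, F (ξ - η) * G η

/-- The algebra constant of the weighted space. -/
noncomputable def algConst (p : ℝ) : ℝ≥0∞ :=
  ENNReal.ofReal (2 ^ (2 * p)) * (2 * ∫⁻ x, ((wt p x) ^ 2)⁻¹)

lemma measurable_wt (p : ℝ) : Measurable (wt p) := by
  unfold wt; fun_prop

lemma one_le_weight (x : ℝ × ℝ) : 1 ≤ 1 + |x.1| + |x.2| := by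
  linarith [abs_nonneg x.1, abs_nonneg x.2]

lemma wt_ne_zero (p : ℝ) (x : ℝ × ℝ) : wt p x ≠ 0 := by
  have : 0 < (1 + |x.1| + |x.2|) ^ p := Real.rpow_pos_of_pos (by linarith [one_le_weight x]) p
  simpa [wt] using this

lemma wt_ne_top (p : ℝ) (x : ℝ × ℝ) : wt p x ≠ ⊤ := ENNReal.ofReal_ne_top

lemma wt_sq (p : ℝ) (x : ℝ × ℝ) :
    wt p x ^ 2 = ENNReal.ofReal ((1 + |x.1| + |x.2|) ^ (2 * p)) := by
  have h : 0 ≤ 1 + |x.1| + |x.2| := by linarith [one_le_weight x]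
  rw [wt, ← ENNReal.ofReal_pow (by positivity), ← Real.rpow_natCast, ← Real.rpow_mul h,
    mul_comm p]
  norm_num

lemma wt_sq_le {p : ℝ} (hp : 0 ≤ p) (ξ η : ℝ × ℝ) :
    wt p ξ ^ 2 ≤ ENNReal.ofReal (2 ^ (2 * p)) * (wt p (ξ - η) ^ 2 + wt p η ^ 2) := by
  simp only [wt_sq]
  rw [← ENNReal.ofReal_add (by positivity) (by positivity), ← ENNReal.ofReal_mul (by positivity)]
  apply ENNReal.ofReal_le_ofReal
  set s := 1 + |(ξ - η).1| + |(ξ - η).2|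
  set t := 1 + |η.1| + |η.2|
  have hs : 0 ≤ s := by positivity
  have ht : 0 ≤ t := by positivity
  have hst : 1 + |ξ.1| + |ξ.2| ≤ s + t := by
    have h₁ := abs_add_le (ξ.1 - η.1) η.1
    have h₂ := abs_add_le (ξ.2 - η.2) η.2
    simp only [sub_add_cancel] at h₁ h₂
    simp only [s, t, Prod.fst_sub, Prod.snd_sub]
    linarith
  calc (1 + |ξ.1| + |ξ.2|) ^ (2 * p) ≤ (2 * max s t) ^ (2 * p) := by
        apply Real.rpow_le_rpow (by positivity) _ (by positivity)
        linarith [le_max_left s t, le_max_right s t]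
    _ = 2 ^ (2 * p) * (max s t) ^ (2 * p) :=
        Real.mul_rpow (by positivity) (le_max_of_le_left hs)
    _ ≤ 2 ^ (2 * p) * (s ^ (2 * p) + t ^ (2 * p)) := by
        gcongr
        have h₁ : 0 ≤ s ^ (2 * p) := by positivity
        have h₂ : 0 ≤ t ^ (2 * p) := by positivity
        rcases max_choice s t with h | h <;> rw [h] <;> linarith

lemma algConst_lt_top {p : ℝ} (hp : 1 < p) : algConst p < ⊤ := by
  have hint : Integrable (fun x : ℝ × ℝ => (1 + ‖x‖) ^ (-(2 * p))) :=
    integrable_one_add_norm (by simp; linarith)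
  have hfin : ∫⁻ x, ((wt p x) ^ 2)⁻¹ < ⊤ := by
    refine lt_of_le_of_lt (lintegral_mono fun x => ?_) hint.lintegral_lt_top
    have h : 0 < 1 + |x.1| + |x.2| := by linarith [one_le_weight x]
    rw [wt_sq, ← ENNReal.ofReal_inv_of_pos (by positivity), ← Real.rpow_neg h.le]
    apply ENNReal.ofReal_le_ofReal
    apply Real.rpow_le_rpow_of_nonpos (by positivity) _ (by linarith)
    have : ‖x‖ ≤ |x.1| + |x.2| := by
      rw [Prod.norm_def, Real.norm_eq_abs, Real.norm_eq_abs]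
      exact max_le (by linarith [abs_nonneg x.2]) (by linarith [abs_nonneg x.1])
    linarith
  exact ENNReal.mul_lt_top ENNReal.ofReal_lt_top (ENNReal.mul_lt_top (by simp) hfin)

lemma lintegral_mul_sq_le {α : Type*} [MeasurableSpace α] {ν : Measure α} {f g : α → ℝ≥0∞}
    (hf : AEMeasurable f ν) (hg : AEMeasurable g ν) :
    (∫⁻ x, f x * g x ∂ν) ^ 2 ≤ (∫⁻ x, f x ^ 2 ∂ν) * ∫⁻ x, g x ^ 2 ∂ν := by
  have h := ENNReal.lintegral_mul_le_Lp_mul_Lq ν Real.HolderConjugate.two_two hf hg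
  simp only [Pi.mul_apply, ENNReal.rpow_two] at h
  calc (∫⁻ x, f x * g x ∂ν) ^ 2
      ≤ ((∫⁻ x, f x ^ 2 ∂ν) ^ (1 / 2 : ℝ) * (∫⁻ x, g x ^ 2 ∂ν) ^ (1 / 2 : ℝ)) ^ 2 := by gcongr
    _ = _ := by
      rw [mul_pow, ← ENNReal.rpow_two, ← ENNReal.rpow_two, ← ENNReal.rpow_mul, ← ENNReal.rpow_mul]
      norm_num

lemma lconv_comm (F G : ℝ × ℝ → ℝ≥0∞) : lconv F G = lconv G F := by
  funext ξ
  rw [lconv, ← lintegral_sub_left_eq_self _ ξ]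
  simp [lconv, mul_comm]

lemma measurable_lconv {F G : ℝ × ℝ → ℝ≥0∞} (hF : Measurable F) (hG : Measurable G) :
    Measurable (lconv F G) := by
  unfold lconv
  have h : Measurable fun z : (ℝ × ℝ) × (ℝ × ℝ) => F (z.1 - z.2) * G z.2 := by fun_prop
  exact h.lintegral_prod_right'

lemma lintegral_lconv {F G : ℝ × ℝ → ℝ≥0∞} (hF : Measurable F) (hG : Measurable G) :
    ∫⁻ ξ, lconv F G ξ = (∫⁻ ξ, F ξ) * ∫⁻ ξ, G ξ := by
  unfold lconv
  rw [lintegral_lintegral_swap (by fun_prop)]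
  have h (η : ℝ × ℝ) : ∫⁻ ξ, F (ξ - η) * G η = (∫⁻ ξ, F ξ) * G η := by
    rw [lintegral_mul_const _ (by fun_prop), lintegral_sub_right_eq_self F η]
  simp_rw [h]
  rw [lintegral_const_mul _ hG]

lemma lintegral_inv_wt_mul_le {p : ℝ} (hp : 0 ≤ p) (ξ : ℝ × ℝ) :
    wt p ξ ^ 2 * ∫⁻ η, ((wt p (ξ - η) * wt p η)⁻¹) ^ 2 ≤ algConst p := by
  have hm := measurable_wt p
  have hpt (η : ℝ × ℝ) : wt p ξ ^ 2 * ((wt p (ξ - η) * wt p η)⁻¹) ^ 2 ≤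
      ENNReal.ofReal (2 ^ (2 * p)) * ((wt p (ξ - η) ^ 2)⁻¹ + (wt p η ^ 2)⁻¹) := by
    have ha := wt_ne_zero p (ξ - η)
    have ha' := wt_ne_top p (ξ - η)
    have hb := wt_ne_zero p η
    have hb' := wt_ne_top p η
    refine (mul_le_mul_left (wt_sq_le hp ξ η) _).trans_eq ?_
    generalize wt p (ξ - η) = a at *
    generalize wt p η = b at *
    have h₁ : a ^ 2 * (a ^ 2)⁻¹ = 1 := ENNReal.mul_inv_cancel (by simpa) (by simpa using ha')
    have h₂ : b ^ 2 * (b ^ 2)⁻¹ = 1 := ENNReal.mul_inv_cancel (by simpa) (by simpa using hb')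
    rw [ENNReal.mul_inv (Or.inl ha) (Or.inl ha'), mul_pow, ← ENNReal.inv_pow, ← ENNReal.inv_pow,
      mul_assoc]
    congr 1
    calc _ = (a ^ 2 * (a ^ 2)⁻¹) * (b ^ 2)⁻¹ + (b ^ 2 * (b ^ 2)⁻¹) * (a ^ 2)⁻¹ := by ring
      _ = _ := by rw [h₁, h₂]; ring
  rw [← lintegral_const_mul _ (by fun_prop)]
  refine (lintegral_mono hpt).trans_eq ?_
  rw [lintegral_const_mul _ (by fun_prop), lintegral_add_left (by fun_prop),
    lintegral_sub_left_eq_self (fun η => (wt p η ^ 2)⁻¹) ξ, algConst,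
    two_mul (∫⁻ x, _)]

/-- The weighted space is an algebra under convolution. -/
lemma wsq_lconv_le {p : ℝ} (hp : 0 ≤ p) {F G : ℝ × ℝ → ℝ≥0∞} (hF : Measurable F)
    (hG : Measurable G) : wsq p (lconv F G) ≤ algConst p * (wsq p F * wsq p G) := by
  have hm := measurable_wt p
  have hpt (ξ : ℝ × ℝ) : (wt p ξ * lconv F G ξ) ^ 2 ≤
      algConst p * lconv (fun x => (wt p x * F x) ^ 2) (fun x => (wt p x * G x) ^ 2) ξ := by
    have hsplit : lconv F G ξ = ∫⁻ η, (wt p (ξ - η) * wt p η)⁻¹ *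
        ((wt p (ξ - η) * F (ξ - η)) * (wt p η * G η)) := by
      refine lintegral_congr fun η => ?_
      have h := ENNReal.inv_mul_cancel (mul_ne_zero (wt_ne_zero p (ξ - η)) (wt_ne_zero p η))
        (ENNReal.mul_ne_top (wt_ne_top p (ξ - η)) (wt_ne_top p η))
      rw [mul_mul_mul_comm, ← mul_assoc, h, one_mul]
    rw [mul_pow, hsplit]
    calc _ ≤ wt p ξ ^ 2 * ((∫⁻ η, ((wt p (ξ - η) * wt p η)⁻¹) ^ 2) *
          ∫⁻ η, ((wt p (ξ - η) * F (ξ - η)) * (wt p η * G η)) ^ 2) := by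
          gcongr
          exact lintegral_mul_sq_le (by fun_prop) (by fun_prop)
      _ ≤ _ := by
          rw [← mul_assoc]
          simp only [mul_pow _ _ 2, lconv]
          gcongr
          simpa only [mul_pow] using lintegral_inv_wt_mul_le hp ξ
  refine (lintegral_mono hpt).trans_eq ?_
  rw [lintegral_const_mul _ (measurable_lconv (by fun_prop) (by fun_prop)),
    lintegral_lconv (by fun_prop) (by fun_prop), wsq, wsq]

lemma ae_lt_top_of_wsq_lt_top {p : ℝ} {F : ℝ × ℝ → ℝ≥0∞} (hF : Measurable F)
    (h : wsq p F < ⊤) : ∀ᵐ x, F x < ⊤ := by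
  have hm := measurable_wt p
  filter_upwards [ae_lt_top (by fun_prop) h.ne] with x hx
  rw [lt_top_iff_ne_top]
  rintro hF
  simp [hF, ENNReal.mul_top (wt_ne_zero p x)] at hx

lemma wsq_mono {p : ℝ} {F G : ℝ × ℝ → ℝ≥0∞} (h : ∀ x, F x ≤ G x) : wsq p F ≤ wsq p G :=
  lintegral_mono fun x => by dsimp only; gcongr; exact h x

lemma wsq_const_mul (p : ℝ) (c : ℝ≥0∞) {F : ℝ × ℝ → ℝ≥0∞} (hF : Measurable F) :
    wsq p (fun x => c * F x) = c ^ 2 * wsq p F := by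
  have hm := measurable_wt p
  rw [wsq, wsq, ← lintegral_const_mul _ (by fun_prop)]
  exact lintegral_congr fun x => by ring

lemma wnorm_eq (p : ℝ) (v : ℝ × ℝ → ℂ) : wnorm p v = wsq p (fun x => ‖v x‖ₑ) ^ (1 / 2 : ℝ) := by
  simp only [wnorm, wsq, mul_pow, wt_sq]
  rfl

lemma wnorm_sq (p : ℝ) (v : ℝ × ℝ → ℂ) : wnorm p v ^ 2 = wsq p (fun x => ‖v x‖ₑ) := by
  rw [wnorm_eq, ← ENNReal.rpow_two, ← ENNReal.rpow_mul]
  norm_num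

lemma measurable_dag {v : ℝ × ℝ → ℂ} (hv : Measurable v) : Measurable (dag v) :=
  Complex.continuous_conj.measurable.comp (hv.comp measurable_neg)

lemma wsq_dag (p : ℝ) (v : ℝ × ℝ → ℂ) :
    wsq p (fun x => ‖dag v x‖ₑ) = wsq p (fun x => ‖v x‖ₑ) := by
  rw [wsq, wsq, ← lintegral_neg_eq_self]
  refine lintegral_congr fun x => ?_
  simp [dag, wt, enorm_eq_nnnorm]

lemma measurable_conv {f g : ℝ × ℝ → ℂ} (hf : Measurable f) (hg : Measurable g) :
    Measurable (conv f g) := by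
  unfold conv
  have h : Measurable fun z : (ℝ × ℝ) × (ℝ × ℝ) => f (z.1 - z.2) * g z.2 := by fun_prop
  exact h.stronglyMeasurable.integral_prod_right.measurable

lemma enorm_conv_le (f g : ℝ × ℝ → ℂ) (ξ : ℝ × ℝ) :
    ‖conv f g ξ‖ₑ ≤ lconv (fun x => ‖f x‖ₑ) (fun x => ‖g x‖ₑ) ξ := by
  refine (enorm_integral_le_lintegral_enorm _).trans_eq ?_
  simp [lconv]

lemma lconv_mono {F F' G G' : ℝ × ℝ → ℝ≥0∞} (hF : ∀ x, F x ≤ F' x) (hG : ∀ x, G x ≤ G' x)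
    (ξ : ℝ × ℝ) : lconv F G ξ ≤ lconv F' G' ξ :=
  lintegral_mono fun _ => mul_le_mul' (hF _) (hG _)

lemma integrable_conv_of_le {f g : ℝ × ℝ → ℂ} (hf : Measurable f) (hg : Measurable g)
    {F G : ℝ × ℝ → ℝ≥0∞} (hF : ∀ x, ‖f x‖ₑ ≤ F x) (hG : ∀ x, ‖g x‖ₑ ≤ G x) {ξ : ℝ × ℝ}
    (h : lconv F G ξ < ⊤) : Integrable fun η => f (ξ - η) * g η := by
  refine ⟨by fun_prop, lt_of_le_of_lt ?_ h⟩
  simpa [lconv] using lconv_mono hF hG ξ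

lemma measurable_sigmaMul : Measurable sigmaMul :=
  Measurable.ite (measurableSet_singleton 0) measurable_const (by fun_prop)

lemma enorm_sigmaMul_le_one (x : ℝ × ℝ) : ‖(sigmaMul x : ℂ)‖ₑ ≤ 1 := by
  have h : ‖(sigmaMul x : ℂ)‖ ≤ 1 := by
    rw [Complex.norm_real, Real.norm_eq_abs, sigmaMul]
    split_ifs
    · simp
    · rw [abs_of_nonneg (by positivity)]
      exact div_le_one_of_le₀ (by nlinarith [sq_nonneg x.2]) (by positivity)
  rw [← ofReal_norm]
  exact ENNReal.ofReal_le_one.2 h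

/-- **Bound for the Davey–Stewartson nonlinearity.** For `p > 1` there is a constant
`C > 0` depending only on `p` such that for all measurable `v` with `‖v‖_p < ∞`, every
convolution integral in `L(v)` converges absolutely a.e. and
`‖L(v)‖_p ≤ C (|γ| + |λμ|) ‖v‖_p³`. -/
theorem Lop_bound (p : ℝ) (hp : 1 < p) :
    ∃ C : ℝ≥0∞, 0 < C ∧ C < ⊤ ∧
      ∀ (γ lam μ : ℝ) (v : ℝ × ℝ → ℂ), Measurable v → wnorm p v < ⊤ →
        (∀ᵐ ξ : ℝ × ℝ, Integrable fun η => v (ξ - η) * dag v η) ∧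
        (∀ᵐ ξ : ℝ × ℝ, Integrable fun η => conv v (dag v) (ξ - η) * v η) ∧
        (∀ᵐ ξ : ℝ × ℝ, Integrable fun η => v (ξ - η) * ((sigmaMul η : ℂ) * conv v (dag v) η)) ∧
        wnorm p (Lop γ lam μ v) ≤
          C * ENNReal.ofReal (|γ| + |lam * μ|) * (wnorm p v) ^ 3 := by
  have hp₀ : 0 ≤ p := by linarith
  have hK := algConst_lt_top hp
  refine ⟨algConst p + 1, by simp, ENNReal.add_lt_top.2 ⟨hK, by simp⟩, ?_⟩
  intro γ lam μ v hv hfin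
  set V : ℝ × ℝ → ℝ≥0∞ := fun x => ‖v x‖ₑ with hV
  set D : ℝ × ℝ → ℝ≥0∞ := fun x => ‖dag v x‖ₑ with hD
  have hd := measurable_dag hv
  have hVm : Measurable V := hv.enorm
  have hDm : Measurable D := hd.enorm
  have hVfin : wsq p V < ⊤ := by
    rw [← wnorm_sq]; exact ENNReal.pow_lt_top hfin
  set U := lconv V D with hU
  have hUm : Measurable U := measurable_lconv hVm hDm
  have hUle : wsq p U ≤ algConst p * (wsq p V * wsq p V) := by
    refine (wsq_lconv_le hp₀ hVm hDm).trans_eq ?_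
    rw [hD, wsq_dag]
  have hUfin : wsq p U < ⊤ :=
    hUle.trans_lt (ENNReal.mul_lt_top hK (ENNReal.mul_lt_top hVfin hVfin))
  set X := lconv U V with hX
  have hXm : Measurable X := measurable_lconv hUm hVm
  have hXle : wsq p X ≤ algConst p * (wsq p U * wsq p V) := wsq_lconv_le hp₀ hUm hVm
  have hXfin : wsq p X < ⊤ :=
    hXle.trans_lt (ENNReal.mul_lt_top hK (ENNReal.mul_lt_top hUfin hVfin))
  have hXcomm : lconv V U = X := lconv_comm V U
  have hc := measurable_conv hv hd
  have hcU : ∀ x, ‖conv v (dag v) x‖ₑ ≤ U x := enorm_conv_le v (dag v)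
  have hσm : Measurable fun η => (sigmaMul η : ℂ) * conv v (dag v) η :=
    (Complex.measurable_ofReal.comp measurable_sigmaMul).mul hc
  have hσU : ∀ x, ‖(sigmaMul x : ℂ) * conv v (dag v) x‖ₑ ≤ U x := fun x => by
    rw [enorm_mul]
    exact (mul_le_mul' (enorm_sigmaMul_le_one x) (hcU x)).trans_eq (one_mul _)
  have hXae := ae_lt_top_of_wsq_lt_top hXm hXfin
  refine ⟨?_, ?_, ?_, ?_⟩
  · filter_upwards [ae_lt_top_of_wsq_lt_top hUm hUfin] with ξ hξ
    exact integrable_conv_of_le hv hd (fun _ => le_rfl) (fun _ => le_rfl) hξ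
  · filter_upwards [hXae] with ξ hξ
    exact integrable_conv_of_le hc hv hcU (fun _ => le_rfl) hξ
  · filter_upwards [hXae] with ξ hξ
    rw [← hXcomm] at hξ
    exact integrable_conv_of_le hv hσm (fun _ => le_rfl) hσU hξ
  · have hL : ∀ x, ‖Lop γ lam μ v x‖ₑ ≤ ENNReal.ofReal (|γ| + |lam * μ|) * X x := fun x => by
      have h₁ : ‖conv (conv v (dag v)) v x‖ₑ ≤ X x :=
        (enorm_conv_le _ _ x).trans (lconv_mono hcU (fun _ => le_rfl) x)
      have h₂ : ‖conv v (fun η => (sigmaMul η : ℂ) * conv v (dag v) η) x‖ₑ ≤ X x := by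
        rw [← hXcomm]
        exact (enorm_conv_le _ _ x).trans (lconv_mono (fun _ => le_rfl) hσU x)
      have hre (r : ℝ) : ‖(r : ℂ)‖ₑ = ENNReal.ofReal |r| := by
        rw [← ofReal_norm, Complex.norm_real, Real.norm_eq_abs]
      rw [Lop, ENNReal.ofReal_add (abs_nonneg _) (abs_nonneg _), add_mul]
      refine (enorm_add_le _ _).trans ?_
      rw [enorm_mul, enorm_mul, hre, hre]
      gcongr
    have hsq : wnorm p (Lop γ lam μ v) ^ 2 ≤
        (algConst p * ENNReal.ofReal (|γ| + |lam * μ|) * wnorm p v ^ 3) ^ 2 := by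
      rw [wnorm_sq]
      calc _ ≤ ENNReal.ofReal (|γ| + |lam * μ|) ^ 2 * wsq p X :=
            (wsq_mono hL).trans_eq (wsq_const_mul p _ hXm)
        _ ≤ ENNReal.ofReal (|γ| + |lam * μ|) ^ 2 *
            (algConst p * ((algConst p * (wsq p V * wsq p V)) * wsq p V)) := by
            gcongr
            exact hXle.trans (by gcongr)
        _ = _ := by
            rw [hV, ← wnorm_sq]; ring
    refine ((ENNReal.pow_le_pow_left_iff two_ne_zero).1 hsq).trans ?_
    gcongr
    exact le_self_add
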